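/- Let α, β be independent uniformly random infinite binary sequences, and for k ≥ 1 let I_k be the event that ∑_{j<k} α_j = ∑_{j<k} β_j and ∑_{j<k} j·α_j = ∑_{j<k} j·β_j. Then with positive probability no event I_k occurs, i.e., P[⋂_{k≥1} I_k^c] > 0. -/

import Mathlib

/-- The numerical value of the `j`-th letter of a word `α ∈ {0,1}^K`. -/
def bval {K : ℕ} (α : Fin K → Bool) (j : ℕ) : ℕ :=
  if h : j < K then (if α ⟨j, h⟩ then 1 else 0) else 0


noncomputable def ee (x : ℝ) : ℂ := Complex.exp ((2 * Real.pi * x : ℝ) * Complex.I)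

lemma ee_add (x y : ℝ) : ee (x + y) = ee x * ee y := by
  unfold ee; rw [← Complex.exp_add]; congr 1; push_cast; ring

lemma ee_zero : ee 0 = 1 := by simp [ee]

lemma ee_norm (x : ℝ) : ‖ee x‖ = 1 := by
  unfold ee; exact Complex.norm_exp_ofReal_mul_I _

lemma ee_re (x : ℝ) : (ee x).re = Real.cos (2 * Real.pi * x) := by
  unfold ee; exact Complex.exp_ofReal_mul_I_re _

lemma ee_pow (x : ℝ) (n : ℕ) : ee x ^ n = ee (n * x) := by
  unfold ee; rw [← Complex.exp_nat_mul]; congr 1; push_cast; ring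

lemma ee_int (z : ℤ) : ee z = 1 := by
  unfold ee; rw [Complex.exp_eq_one_iff]; exact ⟨z, by push_cast; ring⟩

lemma ee_eq_one {x : ℝ} (h : ee x = 1) : ∃ z : ℤ, x = z := by
  unfold ee at h; rw [Complex.exp_eq_one_iff] at h
  obtain ⟨z, hz⟩ := h
  refine ⟨z, ?_⟩
  have h2 : ((2 * Real.pi * x : ℝ) : ℂ) = ((2 * Real.pi * z : ℝ) : ℂ) := by
    apply mul_right_cancel₀ Complex.I_ne_zero
    rw [hz]; push_cast; ring
  have h3 := Complex.ofReal_injective h2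
  have := Real.pi_pos
  exact mul_left_cancel₀ (by positivity) h3

lemma ee_norm_sq (x : ℝ) : ‖1 + ee x‖ * ‖1 + ee (-x)‖ = 2 + 2 * Real.cos (2 * Real.pi * x) := by
  have h : ee (-x) = (starRingEnd ℂ) (ee x) := by
    unfold ee; rw [← Complex.exp_conj]; congr 1
    rw [map_mul, Complex.conj_ofReal, Complex.conj_I]; push_cast; ring
  have h1 : 1 + ee (-x) = (starRingEnd ℂ) (1 + ee x) := by rw [h]; simp
  rw [h1, Complex.norm_conj, ← sq, ← Complex.normSq_eq_norm_sq]
  have h2 := Complex.normSq_eq_norm_sq (ee x)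
  rw [ee_norm, Complex.normSq_apply] at h2
  rw [Complex.normSq_apply, ← ee_re]
  simp only [Complex.add_re, Complex.add_im, Complex.one_re, Complex.one_im]
  nlinarith

lemma ee_norm_le (x : ℝ) :
    ‖1 + ee x‖ * ‖1 + ee (-x)‖ ≤ 4 * Real.exp (-((1 - Real.cos (2 * Real.pi * x)) / 2)) := by
  rw [ee_norm_sq]
  have := Real.add_one_le_exp (-((1 - Real.cos (2 * Real.pi * x)) / 2))
  linarith

lemma geom_zero (n : ℕ) (hn : 0 < n) (z : ℤ) (hz : ¬ (n : ℤ) ∣ z) :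
    ∑ a ∈ Finset.range n, ee (a * (z / n)) = 0 := by
  have hn' : (n : ℝ) ≠ 0 := by positivity
  have h1 : ee ((z : ℝ) / n) ≠ 1 := by
    intro h
    obtain ⟨w, hw⟩ := ee_eq_one h
    apply hz
    rw [div_eq_iff hn'] at hw
    exact ⟨w, by have : z = w * n := by exact_mod_cast hw
                 rw [this]; ring⟩
  simp_rw [← ee_pow]
  have h2 := geom_sum_mul (ee ((z : ℝ) / n)) n
  rw [ee_pow, mul_div_cancel₀ _ hn', ee_int, sub_self] at h2
  exact (mul_eq_zero.1 h2).resolve_right (sub_ne_zero.2 h1)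

lemma orth (n : ℕ) (hn : 0 < n) (z : ℤ) :
    ∑ a ∈ Finset.range n, ee (a * (z / n)) = if (n : ℤ) ∣ z then (n : ℂ) else 0 := by
  split_ifs with h
  · obtain ⟨w, rfl⟩ := h
    have hn' : (n : ℝ) ≠ 0 := by positivity
    have : ∀ a ∈ Finset.range n, ee (a * (((n * w : ℤ) : ℝ) / n)) = 1 := by
      intro a _
      have : (a : ℝ) * (((n * w : ℤ) : ℝ) / n) = ((a * w : ℤ) : ℝ) := by
        push_cast; field_simp
      rw [this, ee_int]
    rw [Finset.sum_congr rfl this]; simp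
  · exact geom_zero n hn z h

noncomputable def EE (L n p a b : ℕ) : ℝ :=
  Real.exp (-∑ j ∈ Finset.Ico L (L + n),
    (1 - Real.cos (2 * Real.pi * (a / p + j * (b / n)))) / 2)

lemma EE_b (L n p a b : ℕ) (hb : 0 < b) (hbn : b < n) : EE L n p a b ≤ 8 / (n : ℝ) ^ 2 := by
  have hn : 0 < n := by omega
  have h0 : ∑ j ∈ Finset.Ico L (L + n), Real.cos (2 * Real.pi * (a / p + j * (b / n))) = 0 := by
    simp_rw [← ee_re]
    rw [← Complex.re_sum, Finset.sum_Ico_eq_sum_range]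
    have : ∀ i : ℕ, ee (a / p + (L + i : ℕ) * (b / n))
        = ee (a / p + L * (b / n)) * ee (i * ((b : ℤ) / n)) := by
      intro i; rw [← ee_add]; congr 1; push_cast; ring
    simp_rw [this]
    rw [← Finset.mul_sum, show L + n - L = n by omega, geom_zero n hn]
    · simp
    · intro h
      have := Int.le_of_dvd (by exact_mod_cast hb) h
      omega
  have h1 : ∑ j ∈ Finset.Ico L (L + n),
      (1 - Real.cos (2 * Real.pi * (a / p + j * (b / n)))) / 2 = n / 2 := by
    rw [← Finset.sum_div, Finset.sum_sub_distrib, h0]; simp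
  unfold EE
  rw [h1, Real.exp_neg, inv_le_comm₀ (Real.exp_pos _) (by positivity)]
  have := Real.quadratic_le_exp_of_nonneg (x := (n : ℝ) / 2) (by positivity)
  rw [inv_div]
  have h3 : (0:ℝ) < n := by exact_mod_cast hn
  nlinarith

lemma EE_a (L n p a : ℕ) (ha : 0 < a) (hap : a < p) (hn : 0 < n) :
    EE L n p a 0 ≤ (p : ℝ) ^ 2 / n := by
  have hp : (0:ℝ) < p := by exact_mod_cast (by omega : 0 < p)
  have hn' : (0:ℝ) < n := by exact_mod_cast hn
  have hpi := Real.pi_pos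
  have key : Real.cos (2 * Real.pi * (a / p)) ≤ 1 - 8 / (p : ℝ) ^ 2 := by
    have aux : ∀ c : ℝ, 1 ≤ c → c ≤ p / 2 → Real.cos (2 * Real.pi * (c / p)) ≤ 1 - 8 / (p : ℝ) ^ 2 := by
      intro c hc hc2
      have h1 : |2 * Real.pi * (c / p)| ≤ Real.pi := by
        rw [abs_of_nonneg (by positivity)]
        have : c / p ≤ 1 / 2 := by rw [div_le_iff₀ hp]; linarith
        nlinarith
      have h2 := Real.cos_le_one_sub_mul_cos_sq h1
      have h3 : 2 / Real.pi ^ 2 * (2 * Real.pi * (c / p)) ^ 2 = 8 * c ^ 2 / p ^ 2 := by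
        field_simp; ring
      have h4 : 8 / (p : ℝ) ^ 2 ≤ 8 * c ^ 2 / p ^ 2 := by
        gcongr; nlinarith
      linarith
    by_cases h : (a : ℝ) ≤ p / 2
    · exact aux a (by exact_mod_cast ha) h
    · have h1 : (a : ℝ) + 1 ≤ p := by exact_mod_cast hap
      have := aux (p - a) (by linarith) (by linarith)
      have h2 : 2 * Real.pi * ((p - a) / p) = 2 * Real.pi - 2 * Real.pi * (a / p) := by
        field_simp
      rwa [h2, Real.cos_two_pi_sub] at this
  have h1 : (4 * n / (p : ℝ) ^ 2) ≤ ∑ j ∈ Finset.Ico L (L + n),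
      (1 - Real.cos (2 * Real.pi * (a / p + j * ((0 : ℕ) / n)))) / 2 := by
    simp only [Nat.cast_zero, zero_div, mul_zero, add_zero, Finset.sum_const, Nat.card_Ico,
      add_tsub_cancel_left, nsmul_eq_mul]
    have : 4 * n / (p : ℝ) ^ 2 = n * ((8 / (p : ℝ) ^ 2) / 2) := by ring
    rw [this]; gcongr; linarith
  unfold EE
  rw [Real.exp_neg, inv_le_comm₀ (Real.exp_pos _) (by positivity), inv_div]
  have h2 := Real.add_one_le_exp (∑ j ∈ Finset.Ico L (L + n),
      (1 - Real.cos (2 * Real.pi * (a / p + j * ((0 : ℕ) / n)))) / 2)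
  have h3 : (n : ℝ) / p ^ 2 ≤ 4 * n / (p : ℝ) ^ 2 := by gcongr; linarith
  linarith

lemma EE_le_one (L n p a b : ℕ) : EE L n p a b ≤ 1 := by
  unfold EE
  rw [Real.exp_le_one_iff, neg_nonpos]
  apply Finset.sum_nonneg
  intro j _
  have := Real.cos_le_one (2 * Real.pi * (a / p + j * (b / n)))
  linarith

lemma EE_sum (L n p : ℕ) (hp : 0 < p) (hpn : p ^ 4 ≤ n) :
    ∑ a ∈ Finset.range p, ∑ b ∈ Finset.range n, EE L n p a b ≤ 10 := by
  have hp1 : (1:ℝ) ≤ p := by exact_mod_cast hp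
  have hpn' : (p:ℝ) ^ 4 ≤ n := by exact_mod_cast hpn
  have hn : 0 < n := lt_of_lt_of_le (by positivity) hpn
  have hn' : (0:ℝ) < n := by exact_mod_cast hn
  have h1 : ∀ a ∈ Finset.range p, ∑ b ∈ Finset.range n, EE L n p a b
      ≤ EE L n p a 0 + 8 / n := by
    intro a _
    obtain ⟨m, rfl⟩ : ∃ m, n = m + 1 := ⟨n - 1, by omega⟩
    rw [Finset.sum_range_succ', add_comm]
    gcongr
    calc _ ≤ ∑ b ∈ Finset.range m, 8 / ((m + 1 : ℕ) : ℝ) ^ 2 :=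
          Finset.sum_le_sum fun b hb => EE_b _ _ _ _ _ (by omega)
            (by have := Finset.mem_range.1 hb; omega)
      _ = m * (8 / ((m + 1 : ℕ) : ℝ) ^ 2) := by simp
      _ ≤ ((m + 1 : ℕ) : ℝ) * (8 / ((m + 1 : ℕ) : ℝ) ^ 2) := by gcongr; omega
      _ = _ := by field_simp
  refine (Finset.sum_le_sum h1).trans ?_
  rw [Finset.sum_add_distrib]
  have h2 : ∑ a ∈ Finset.range p, EE L n p a 0 ≤ 1 + 1 := by
    obtain ⟨m, rfl⟩ : ∃ m, p = m + 1 := ⟨p - 1, by omega⟩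
    rw [Finset.sum_range_succ', add_comm]
    gcongr
    · exact EE_le_one _ _ _ _ _
    calc _ ≤ ∑ b ∈ Finset.range m, ((m + 1 : ℕ) : ℝ) ^ 2 / n :=
          Finset.sum_le_sum fun b hb => EE_a _ _ _ _ (by omega)
            (by have := Finset.mem_range.1 hb; omega) hn
      _ = m * (((m + 1 : ℕ) : ℝ) ^ 2 / n) := by simp
      _ ≤ ((m + 1 : ℕ) : ℝ) * (((m + 1 : ℕ) : ℝ) ^ 2 / n) := by gcongr; omega
      _ = ((m + 1 : ℕ) : ℝ) ^ 3 / n := by ring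
      _ ≤ 1 := by
        rw [div_le_one hn']
        refine le_trans ?_ hpn'
        exact pow_le_pow_right₀ hp1 (by norm_num)
  have h3 : ∑ a ∈ Finset.range p, (8:ℝ) / n ≤ 8 := by
    simp only [Finset.sum_const, Finset.card_range, nsmul_eq_mul]
    rw [← mul_div_assoc, div_le_iff₀ hn']
    nlinarith [pow_le_pow_right₀ hp1 (show 1 ≤ 4 by norm_num)]
  linarith

lemma sum_prod_bool (K : ℕ) (f : ℕ → Bool → ℂ) :
    ∑ α : Fin K → Bool, ∏ j : Fin K, f j (α j) = ∏ j ∈ Finset.range K, (f j true + f j false) := by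
  rw [Finset.prod_range]
  have := Finset.prod_univ_sum (fun _ : Fin K => (Finset.univ : Finset Bool))
    (fun j b => f j b)
  rw [Fintype.piFinset_univ] at this
  rw [← this]
  simp

lemma ee_sum (s : Finset ℕ) (x : ℕ → ℝ) : ee (∑ j ∈ s, x j) = ∏ j ∈ s, ee (x j) := by
  classical
  induction s using Finset.induction_on with
  | empty => simp [ee_zero]
  | insert a s ha ih => rw [Finset.sum_insert ha, Finset.prod_insert ha, ee_add, ih]

lemma ee_bval (K k : ℕ) (hk : k ≤ K) (α : Fin K → Bool) (x : ℕ → ℝ) :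
    ee (∑ j ∈ Finset.range k, x j * bval α j)
      = ∏ j : Fin K, (if (j : ℕ) < k then (if α j then ee (x j) else 1) else 1) := by
  rw [ee_sum]
  have h1 : ∏ j ∈ Finset.range k, ee (x j * bval α j)
      = ∏ j ∈ Finset.range K, (if j < k then ee (x j * bval α j) else 1) := by
    rw [← Finset.prod_filter]
    congr 1
    ext j; simp; omega
  rw [h1, Finset.prod_range]
  refine Finset.prod_congr rfl fun j _ => ?_
  by_cases hj : (j : ℕ) < k
  · by_cases ha : α j <;> simp [hj, bval, ha, ee_zero]
  · simp [hj]

/-- forced start -/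
def Forced (L K : ℕ) (p : (Fin K → Bool) × (Fin K → Bool)) : Prop :=
  ∀ j : Fin K, (j : ℕ) < L → p.1 j = true ∧ p.2 j = false

open Classical in
noncomputable def ww (L K : ℕ) (p : (Fin K → Bool) × (Fin K → Bool)) : ℝ :=
  if Forced L K p then 1 else 0

noncomputable def fA (L k : ℕ) (x : ℕ → ℝ) (j : ℕ) (b : Bool) : ℂ :=
  (if j < L then (if b then 1 else 0) else 1) * (if j < k then (if b then ee (x j) else 1) else 1)

noncomputable def fB (L k : ℕ) (x : ℕ → ℝ) (j : ℕ) (b : Bool) : ℂ :=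
  (if j < L then (if b then 0 else 1) else 1) * (if j < k then (if b then ee (- x j) else 1) else 1)

lemma ww_eq (L K : ℕ) (p : (Fin K → Bool) × (Fin K → Bool)) :
    (ww L K p : ℂ) = (∏ j : Fin K, (if (j : ℕ) < L then (if p.1 j then (1:ℂ) else 0) else 1)) *
      (∏ j : Fin K, (if (j : ℕ) < L then (if p.2 j then (0:ℂ) else 1) else 1)) := by
  unfold ww
  rw [← Finset.prod_mul_distrib]
  split_ifs with h
  · rw [Finset.prod_eq_one]
    · simp
    · intro j _
      by_cases hj : (j : ℕ) < L
      · simp [hj, h j hj]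
      · simp [hj]
  · unfold Forced at h
    push Not at h
    obtain ⟨j, hj, h⟩ := h
    symm
    rw [Complex.ofReal_zero]
    apply Finset.prod_eq_zero (Finset.mem_univ j)
    by_cases h1 : p.1 j = true
    · have := h h1
      simp [hj, this]
    · simp [hj, h1]

lemma point (L K k : ℕ) (hk : k ≤ K) (x : ℕ → ℝ) (p : (Fin K → Bool) × (Fin K → Bool)) :
    (ww L K p : ℂ) * ee (∑ j ∈ Finset.range k, x j * ((bval p.1 j : ℝ) - bval p.2 j))
    = (∏ j : Fin K, fA L k x j (p.1 j)) * ∏ j : Fin K, fB L k x j (p.2 j) := by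
  unfold fA fB
  rw [Finset.prod_mul_distrib, Finset.prod_mul_distrib, ww_eq, ← ee_bval K k hk p.1 x,
    ← ee_bval K k hk p.2 (fun j => - x j)]
  have : ∑ j ∈ Finset.range k, x j * ((bval p.1 j : ℝ) - bval p.2 j)
    = (∑ j ∈ Finset.range k, x j * bval p.1 j) + ∑ j ∈ Finset.range k, (-x j) * bval p.2 j := by
    rw [← Finset.sum_add_distrib]; exact Finset.sum_congr rfl fun j _ => by ring
  rw [this, ee_add]; ring

lemma sum_point (L K k : ℕ) (hk : k ≤ K) (x : ℕ → ℝ) :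
    ∑ p : (Fin K → Bool) × (Fin K → Bool),
    (ww L K p : ℂ) * ee (∑ j ∈ Finset.range k, x j * ((bval p.1 j : ℝ) - bval p.2 j))
    = ∏ j ∈ Finset.range K, ((fA L k x j true + fA L k x j false) *
        (fB L k x j true + fB L k x j false)) := by
  simp_rw [point L K k hk x]
  rw [Fintype.sum_prod_type, Finset.prod_mul_distrib, ← sum_prod_bool, ← sum_prod_bool,
    Finset.sum_mul_sum]

noncomputable def cc (L K : ℕ) : ℝ := ∏ j ∈ Finset.range K, (if j < L then (1:ℝ) else 4)

lemma cc_pos (L K : ℕ) : 0 < cc L K := by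
  unfold cc; apply Finset.prod_pos; intro j _; split_ifs <;> norm_num

lemma sum_ww (L K : ℕ) : ∑ p, ww L K p = cc L K := by
  have h := sum_point L K 0 (by omega) (fun _ => 0)
  simp only [Finset.range_zero, Finset.sum_empty, ee_zero, mul_one] at h
  apply Complex.ofReal_injective
  rw [Complex.ofReal_sum, h]
  unfold cc fA fB
  rw [Complex.ofReal_prod]
  refine Finset.prod_congr rfl fun j _ => ?_
  by_cases hj : j < L <;> simp [hj]; norm_num

lemma cc_ge (L K : ℕ) : (4:ℝ) ^ K / 4 ^ L ≤ cc L K := by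
  rw [div_le_iff₀ (by positivity)]
  induction K with
  | zero => simp [cc]; exact one_le_pow₀ (by norm_num)
  | succ K ih =>
    by_cases h : K < L
    · have : cc L (K+1) = 1 := by
        unfold cc; apply Finset.prod_eq_one; intro j hj
        have := Finset.mem_range.1 hj
        rw [if_pos (by omega)]
      rw [this, one_mul]
      exact pow_le_pow_right₀ (by norm_num) h
    · have : cc L (K+1) = cc L K * 4 := by
        unfold cc; rw [Finset.prod_range_succ, if_neg h]
      rw [this, pow_succ]; linarith

lemma norm_point (L K n : ℕ) (hk : L + n ≤ K) (x : ℕ → ℝ) :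
    ‖∑ p : (Fin K → Bool) × (Fin K → Bool), (ww L K p : ℂ) *
      ee (∑ j ∈ Finset.range (L + n), x j * ((bval p.1 j : ℝ) - bval p.2 j))‖
    ≤ cc L K * Real.exp (-∑ j ∈ Finset.Ico L (L + n), (1 - Real.cos (2 * Real.pi * x j)) / 2) := by
  rw [sum_point L K _ hk, norm_prod, ← Finset.sum_neg_distrib, Real.exp_sum]
  have h1 : ∏ j ∈ Finset.Ico L (L + n), Real.exp (-((1 - Real.cos (2 * Real.pi * x j)) / 2))
      = ∏ j ∈ Finset.range K, (if L ≤ j ∧ j < L + n then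
        Real.exp (-((1 - Real.cos (2 * Real.pi * x j)) / 2)) else 1) := by
    rw [← Finset.prod_filter]
    congr 1
    ext j; simp; omega
  rw [h1]; unfold cc
  rw [← Finset.prod_mul_distrib]
  apply Finset.prod_le_prod
  · intros; positivity
  intro j _
  unfold fA fB
  by_cases h2 : j < L
  · have h3 : j < L + n := by omega
    have h4 : ¬ L ≤ j := by omega
    simp [h2, h3, h4, ee_norm]
  · by_cases h3 : j < L + n
    · have h4 : L ≤ j := by omega
      have := ee_norm_le (x j)
      rw [add_comm 1, add_comm 1] at this
      simpa [h2, h3, h4] using this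
    · simp [h2, h3]; norm_num

lemma bad_bound (L K n q : ℕ) (hk : L + n ≤ K) (hq : 0 < q) (hqn : q ^ 4 ≤ n) 
    (P : (Fin K → Bool) × (Fin K → Bool) → Prop) [DecidablePred P]
    (hP : ∀ p, P p → (∑ j ∈ Finset.range (L + n), bval p.1 j =
                ∑ j ∈ Finset.range (L + n), bval p.2 j) ∧
              (∑ j ∈ Finset.range (L + n), j * bval p.1 j =
                ∑ j ∈ Finset.range (L + n), j * bval p.2 j)) :
    ∑ p, ww L K p * (if P p then 1 else 0) ≤ cc L K * (10 / (q * n)) := by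
  have hn : 0 < n := lt_of_lt_of_le (by positivity) hqn
  have hn' : (0:ℝ) < n := by exact_mod_cast hn
  have hq' : (0:ℝ) < q := by exact_mod_cast hq
  let z1 : (Fin K → Bool) × (Fin K → Bool) → ℤ := fun p =>
    ∑ j ∈ Finset.range (L + n), ((bval p.1 j : ℤ) - bval p.2 j)
  let z2 : (Fin K → Bool) × (Fin K → Bool) → ℤ := fun p =>
    ∑ j ∈ Finset.range (L + n), (j : ℤ) * ((bval p.1 j : ℤ) - bval p.2 j)
  let g : (Fin K → Bool) × (Fin K → Bool) → ℝ := fun p =>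
    (if (q : ℤ) ∣ z1 p then (q:ℝ) else 0) * (if (n : ℤ) ∣ z2 p then (n:ℝ) else 0)
  have hw : ∀ p, 0 ≤ ww L K p := fun p => by unfold ww; split_ifs <;> norm_num
  have hg0 : ∀ p, 0 ≤ g p := fun p => by dsimp [g]; split_ifs <;> positivity
  have hg : ∀ p, (q * n : ℝ) * (if P p then 1 else 0) ≤ g p := by
    intro p
    split_ifs with h
    · obtain ⟨h1, h2⟩ := hP p h
      have e1 : z1 p = 0 := by
        dsimp [z1]; rw [Finset.sum_sub_distrib, sub_eq_zero]; exact_mod_cast h1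
      have e2 : z2 p = 0 := by
        dsimp [z2]; simp_rw [mul_sub]; rw [Finset.sum_sub_distrib, sub_eq_zero]; exact_mod_cast h2
      dsimp [g]; simp [e1, e2]
    · simpa using hg0 p
  have hgc : ∀ p, (g p : ℂ) = ∑ a ∈ Finset.range q, ∑ b ∈ Finset.range n,
      ee (∑ j ∈ Finset.range (L + n), ((a : ℝ) / q + j * ((b : ℝ) / n))
        * ((bval p.1 j : ℝ) - bval p.2 j)) := by
    intro p
    have : (g p : ℂ) = (if (q : ℤ) ∣ z1 p then (q:ℂ) else 0) * (if (n : ℤ) ∣ z2 p then (n:ℂ) else 0) := by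
      dsimp [g]; split_ifs <;> simp
    rw [this, ← orth q hq, ← orth n hn, Finset.sum_mul_sum]
    refine Finset.sum_congr rfl fun a _ => Finset.sum_congr rfl fun b _ => ?_
    rw [← ee_add]
    congr 1
    dsimp [z1, z2]
    push_cast
    rw [Finset.sum_div, Finset.mul_sum, Finset.sum_div, Finset.mul_sum, ← Finset.sum_add_distrib]
    refine Finset.sum_congr rfl fun j _ => ?_
    ring
  have hmain : ∑ p, ww L K p * g p ≤ cc L K * 10 := by
    have h1 : ((∑ p, ww L K p * g p : ℝ) : ℂ) = ∑ a ∈ Finset.range q, ∑ b ∈ Finset.range n,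
        ∑ p, (ww L K p : ℂ) * ee (∑ j ∈ Finset.range (L + n), ((a : ℝ) / q + j * ((b : ℝ) / n))
        * ((bval p.1 j : ℝ) - bval p.2 j)) := by
      rw [Complex.ofReal_sum]
      simp_rw [Complex.ofReal_mul, hgc, Finset.mul_sum]
      rw [Finset.sum_comm]
      refine Finset.sum_congr rfl fun a _ => ?_
      rw [Finset.sum_comm]
    have h2 : ∑ p, ww L K p * g p = ‖((∑ p, ww L K p * g p : ℝ) : ℂ)‖ := by
      rw [Complex.norm_real, Real.norm_of_nonneg]
      exact Finset.sum_nonneg fun p _ => mul_nonneg (hw p) (hg0 p)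
    rw [h2, h1]
    refine (norm_sum_le _ _).trans ?_
    calc _ ≤ ∑ a ∈ Finset.range q, ∑ b ∈ Finset.range n, cc L K * EE L n q a b := by
          refine Finset.sum_le_sum fun a _ => (norm_sum_le _ _).trans
            (Finset.sum_le_sum fun b _ => ?_)
          exact norm_point L K n hk (fun j => (a : ℝ) / q + j * ((b : ℝ) / n))
      _ = cc L K * ∑ a ∈ Finset.range q, ∑ b ∈ Finset.range n, EE L n q a b := by
          simp_rw [Finset.mul_sum]
      _ ≤ _ := by
          gcongr
          · exact (cc_pos L K).le
          · exact EE_sum L n q hq hqn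
  rw [← mul_div_assoc, le_div_iff₀ (by positivity), Finset.sum_mul]
  refine le_trans (Finset.sum_le_sum fun p _ => ?_) hmain
  rw [mul_assoc, mul_comm (if P p then (1:ℝ) else 0)]
  exact mul_le_mul_of_nonneg_left (hg p) (hw p)

lemma exists_q (n : ℕ) (hn : 0 < n) : ∃ q : ℕ, 0 < q ∧ q ^ 4 ≤ n ∧
    (10:ℝ) / (q * n) ≤ 20 * (1 / (n : ℝ) ^ (5/4 : ℝ)) := by
  have hn1 : (1:ℝ) ≤ n := by exact_mod_cast hn
  have hn' : (0:ℝ) < n := by linarith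
  set r : ℝ := (n : ℝ) ^ (1/4 : ℝ) with hr
  have hr1 : 1 ≤ r := Real.one_le_rpow hn1 (by norm_num)
  have hr4 : r ^ 4 = n := by
    rw [hr, ← Real.rpow_natCast, ← Real.rpow_mul hn'.le]; norm_num
  have hf : (⌊r⌋₊ : ℝ) ≤ r := Nat.floor_le (by linarith)
  have hf2 := Nat.lt_floor_add_one r
  have hf0 : 0 < ⌊r⌋₊ := Nat.floor_pos.2 hr1
  have hf1 : (1:ℝ) ≤ ⌊r⌋₊ := by exact_mod_cast hf0
  refine ⟨⌊r⌋₊, hf0, ?_, ?_⟩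
  · have : (⌊r⌋₊ : ℝ) ^ 4 ≤ n := by rw [← hr4]; gcongr
    exact_mod_cast this
  · have h5 : (n : ℝ) ^ (5/4 : ℝ) = r * n := by
      rw [hr]; nth_rewrite 3 [← Real.rpow_one (n : ℝ)]
      rw [← Real.rpow_add hn']; norm_num
    rw [h5, mul_one_div, div_le_div_iff₀ (by positivity) (by positivity)]
    nlinarith

lemma exists_L : ∃ L : ℕ, 0 < L ∧ ∀ M : ℕ,
    ∑ n ∈ Finset.Ico L M, 20 * (1 / (n : ℝ) ^ (5/4 : ℝ)) ≤ 1 / 2 := by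
  have hs : Summable fun n : ℕ => 20 * (1 / (n : ℝ) ^ (5/4 : ℝ)) :=
    (Real.summable_one_div_nat_rpow.2 (by norm_num)).mul_left 20
  obtain ⟨s, hs⟩ := (summable_iff_vanishing_norm.1 hs) (1/2) (by norm_num)
  refine ⟨s.sup id + 1, by omega, fun M => ?_⟩
  have := hs (Finset.Ico (s.sup id + 1) M) (by
    rw [Finset.disjoint_left]
    intro a ha hb
    have h1 := Finset.le_sup (f := id) hb
    have h2 := (Finset.mem_Ico.1 ha).1
    simp only [id] at h1
    omega)
  exact (le_abs_self _).trans this.le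

lemma forced_sum (L K k : ℕ) (hk : k ≤ K) (p : (Fin K → Bool) × (Fin K → Bool))
    (hp : Forced L K p) (h1 : 1 ≤ k) (_ : 0 < L)
    (h : ∑ j ∈ Finset.range k, bval p.1 j = ∑ j ∈ Finset.range k, bval p.2 j) : 2 * L ≤ k := by
  have b1 : ∀ j < min L k, bval p.1 j = 1 := by
    intro j hj
    have : j < K := by omega
    have := (hp ⟨j, this⟩ (by simp; omega)).1
    simp [bval, *]
  have b2 : ∀ j < min L k, bval p.2 j = 0 := by
    intro j hj
    have : j < K := by omega
    have := (hp ⟨j, this⟩ (by simp; omega)).2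
    simp [bval, *]
  have b3 : ∀ j, bval p.2 j ≤ 1 := by
    intro j; unfold bval; split_ifs <;> omega
  have c1 : min L k ≤ ∑ j ∈ Finset.range k, bval p.1 j := by
    calc min L k = ∑ j ∈ Finset.range (min L k), 1 := by simp
      _ = ∑ j ∈ Finset.range (min L k), bval p.1 j :=
        Finset.sum_congr rfl fun j hj => (b1 j (Finset.mem_range.1 hj)).symm
      _ ≤ _ := Finset.sum_le_sum_of_subset (by
          intro j; simp only [Finset.mem_range]; omega)
  have c2 : ∑ j ∈ Finset.range k, bval p.2 j ≤ k - min L k := by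
    rw [← Finset.sum_range_add_sum_Ico _ (min_le_right L k)]
    rw [Finset.sum_eq_zero (fun j hj => b2 j (Finset.mem_range.1 hj)), zero_add]
    refine (Finset.sum_le_sum fun j _ => b3 j).trans ?_
    simp
  omega

open Classical in
/-- With positive probability, no event `I_k` (`k ≥ 1`) occurs, where `I_k`
is the event that two independent uniformly random binary sequences satisfy
`∑_{j<k} α_j = ∑_{j<k} β_j` and `∑_{j<k} j·α_j = ∑_{j<k} j·β_j` (i.e. the two
oriented walks on the Heisenberg Cayley graph meet at step `k`).

Since the event `⋂_{1 ≤ k ≤ K} I_k^c` is a cylinder event depending only on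
the first `K` coordinates, `P[⋂_{k≥1} I_k^c] > 0` is equivalent to the
probabilities of these cylinder events (computed under the uniform measure on
pairs of words in `{0,1}^K`) being bounded below by some `ε > 0` uniformly in
the horizon `K`. -/
theorem no_coincidence_positive_probability :
    ∃ ε > (0 : ℝ), ∀ K : ℕ,
      ε ≤ ((Finset.univ.filter fun p : (Fin K → Bool) × (Fin K → Bool) =>
          ∀ k ∈ Finset.Icc 1 K,
            ¬((∑ j ∈ Finset.range k, bval p.1 j =
                ∑ j ∈ Finset.range k, bval p.2 j) ∧
              (∑ j ∈ Finset.range k, j * bval p.1 j =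
                ∑ j ∈ Finset.range k, j * bval p.2 j))).card : ℝ)
        / (2 ^ K * 2 ^ K) := by
  obtain ⟨L, hL0, hL⟩ := exists_L
  refine ⟨1 / 4 ^ L / 2, by positivity, fun K => ?_⟩
  let I : ℕ → (Fin K → Bool) × (Fin K → Bool) → Prop := fun k p =>
    (∑ j ∈ Finset.range k, bval p.1 j = ∑ j ∈ Finset.range k, bval p.2 j) ∧
      (∑ j ∈ Finset.range k, j * bval p.1 j = ∑ j ∈ Finset.range k, j * bval p.2 j)
  have hw : ∀ p, 0 ≤ ww L K p := fun p => by unfold ww; split_ifs <;> norm_num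
  have hw1 : ∀ p, ww L K p ≤ 1 := fun p => by unfold ww; split_ifs <;> norm_num
  have key : ∑ p, ww L K p ≤ ∑ p, (if ∀ k ∈ Finset.Icc 1 K, ¬ I k p then (1:ℝ) else 0)
      + ∑ p, ∑ n ∈ Finset.Ico L (K - L + 1), ww L K p * (if I (L + n) p then 1 else 0) := by
    rw [← Finset.sum_add_distrib]
    refine Finset.sum_le_sum fun p _ => ?_
    have hnn : ∀ n ∈ Finset.Ico L (K - L + 1),
        0 ≤ ww L K p * (if I (L + n) p then (1:ℝ) else 0) := by
      intro n _; apply mul_nonneg (hw p); split_ifs <;> norm_num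
    split_ifs with h
    · have := Finset.sum_nonneg hnn
      linarith [hw1 p]
    · push Not at h
      obtain ⟨k, hk, hI⟩ := h
      rw [Finset.mem_Icc] at hk
      rw [zero_add]
      by_cases hF : Forced L K p
      · have h2 := forced_sum L K k hk.2 p hF hk.1 hL0 hI.1
        have h3 : k - L ∈ Finset.Ico L (K - L + 1) := by
          rw [Finset.mem_Ico]; omega
        refine le_trans ?_ (Finset.single_le_sum hnn h3)
        rw [show L + (k - L) = k by omega, if_pos hI, mul_one]
      · have : ww L K p = 0 := by unfold ww; rw [if_neg hF]
        simp [this]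
  rw [sum_ww, Finset.sum_comm] at key
  have hbad : ∑ n ∈ Finset.Ico L (K - L + 1), ∑ p, ww L K p * (if I (L + n) p then 1 else 0)
      ≤ cc L K * (1 / 2) := by
    refine le_trans ?_ (mul_le_mul_of_nonneg_left (hL (K - L + 1)) (cc_pos L K).le)
    rw [Finset.mul_sum]
    refine Finset.sum_le_sum fun n hn => ?_
    rw [Finset.mem_Ico] at hn
    obtain ⟨q, hq, hqn, hb⟩ := exists_q n (by omega)
    exact (bad_bound L K n q (by omega) hq hqn (I (L + n)) (fun p h => h)).trans
      (mul_le_mul_of_nonneg_left hb (cc_pos L K).le)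
  have hcard : ((Finset.univ.filter fun p : (Fin K → Bool) × (Fin K → Bool) =>
      ∀ k ∈ Finset.Icc 1 K, ¬ I k p).card : ℝ)
      = ∑ p, (if ∀ k ∈ Finset.Icc 1 K, ¬ I k p then (1:ℝ) else 0) := by
    rw [Finset.card_filter, Nat.cast_sum]
    refine Finset.sum_congr rfl fun p _ => ?_
    split_ifs <;> simp
  rw [← hcard] at key
  have hc := cc_ge L K
  rw [le_div_iff₀ (by positivity)]
  have h4 : (2:ℝ) ^ K * 2 ^ K = 4 ^ K := by rw [← mul_pow]; norm_num
  rw [h4]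
  have h5 : (1:ℝ) / 4 ^ L / 2 * 4 ^ K = 4 ^ K / 4 ^ L / 2 := by ring
  rw [h5]
  refine le_trans (b := _) ?_ (le_of_eq (?_ : ((Finset.univ.filter fun p : (Fin K → Bool) × (Fin K → Bool) =>
      ∀ k ∈ Finset.Icc 1 K, ¬ I k p).card : ℝ) = _))
  · linarith
  · congr
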